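/- Let G be a subcubic simple graph and let M be a maximal matching in G (no edge of G can be added to M while keeping it a matching). Then the graph obtained from G by deleting the edges of M has a proper edge-coloring with 3 colors. -/

import Mathlib

open SimpleGraph

/-- A (partial) edge-coloring `C` is proper on the edge set `E₀`:
any two distinct edges of `E₀` sharing an endpoint get different colors. -/
def ProperOn {V : Type*} (E₀ : Set (Sym2 V)) (C : Sym2 V → ℕ) : Prop :=
  ∀ e ∈ E₀, ∀ f ∈ E₀, e ≠ f → (∃ v, v ∈ e ∧ v ∈ f) → C e ≠ C f

/-- `G` admits a proper edge-coloring using (at most) `t` colors. -/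
def HasProperEdgeColoring {V : Type*} (G : SimpleGraph V) (t : ℕ) : Prop :=
  ∃ C : Sym2 V → ℕ, (∀ e ∈ G.edgeSet, C e < t) ∧ ProperOn G.edgeSet C

/-- The chromatic index `χ'(G)`. -/
noncomputable def chromIndex {V : Type*} (G : SimpleGraph V) : ℕ :=
  sInf {t | HasProperEdgeColoring G t}

/-- Every proper edge-precoloring of at most `k` edges of `G` extends to a
proper edge-coloring of `G` with `t` colors. -/
def PrecoloringExtendable {V : Type*} (G : SimpleGraph V) (k t : ℕ) : Prop :=
  ∀ E₀ : Set (Sym2 V), E₀ ⊆ G.edgeSet → E₀.ncard ≤ k →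
    ∀ c₀ : Sym2 V → ℕ, (∀ e ∈ E₀, c₀ e < t) → ProperOn E₀ c₀ →
      ∃ C : Sym2 V → ℕ, (∀ e ∈ G.edgeSet, C e < t) ∧ ProperOn G.edgeSet C ∧
        ∀ e ∈ E₀, C e = c₀ e

/-- `M` is a matching of `G` given as a set of edges: pairwise disjoint edges of `G`. -/
def IsMatchingSet {V : Type*} (G : SimpleGraph V) (M : Set (Sym2 V)) : Prop :=
  M ⊆ G.edgeSet ∧ ∀ e ∈ M, ∀ f ∈ M, e ≠ f → ¬ ∃ v, v ∈ e ∧ v ∈ f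

/-- `M` is a maximal matching: no edge of `G` can be added to it. -/
def IsMaximalMatchingSet {V : Type*} (G : SimpleGraph V) (M : Set (Sym2 V)) : Prop :=
  IsMatchingSet G M ∧ ∀ e ∈ G.edgeSet, e ∉ M → ¬ IsMatchingSet G (M ∪ {e})

/-- A square matrix of natural numbers all of whose row and column sums equal the same positive
number has a transversal of nonzero entries. -/
lemma exists_perm_forall_ne_zero {n : Type*} [Fintype n] {d : ℕ} (hd : 0 < d)
    (M : n → n → ℕ) (hrow : ∀ i, ∑ j, M i j = d) (hcol : ∀ j, ∑ i, M i j = d) :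
    ∃ σ : Equiv.Perm n, ∀ i, M i (σ i) ≠ 0 := by
  classical
  let f (i : n) : Finset n := {j | M i j ≠ 0}
  have hf (A : Finset n) : A.card ≤ (A.biUnion f).card := by
    have hsum (i : n) : ∑ j ∈ f i, M i j = d := by
      rw [← hrow i, Finset.sum_filter_ne_zero]
    refine Nat.le_of_mul_le_mul_right ?_ hd
    calc A.card * d = ∑ i ∈ A, ∑ j ∈ f i, M i j := by simp [hsum]
      _ ≤ ∑ i ∈ A, ∑ j ∈ A.biUnion f, M i j := Finset.sum_le_sum fun i hi =>
          Finset.sum_le_sum_of_subset (Finset.subset_biUnion_of_mem f hi)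
      _ ≤ ∑ i, ∑ j ∈ A.biUnion f, M i j := Finset.sum_le_sum_of_subset (Finset.subset_univ _)
      _ = (A.biUnion f).card * d := by rw [Finset.sum_comm]; simp [hcol]
  obtain ⟨g, hg, hgf⟩ := (Finset.all_card_le_biUnion_card_iff_exists_injective f).1 hf
  exact ⟨Equiv.ofBijective g (Finite.injective_iff_bijective.1 hg), fun i => by
    simpa [f] using hgf i⟩

/-- The support of a square matrix of natural numbers all of whose row and column sums equal `d`
is covered by `d` permutations. -/
lemma exists_perms_covering_support {n : Type*} [Fintype n] (d : ℕ)
    (M : n → n → ℕ) (hrow : ∀ i, ∑ j, M i j = d) (hcol : ∀ j, ∑ i, M i j = d) :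
    ∃ σ : ℕ → Equiv.Perm n, ∀ i j, M i j ≠ 0 → ∃ k < d, σ k i = j := by
  classical
  induction d generalizing M with
  | zero =>
    refine ⟨fun _ => 1, fun i j h => absurd ?_ h⟩
    exact Finset.sum_eq_zero_iff.1 (hrow i) j (Finset.mem_univ j)
  | succ d ih =>
    obtain ⟨τ, hτ⟩ := exists_perm_forall_ne_zero d.succ_pos M hrow hcol
    have hle (i j : n) : (if τ i = j then 1 else 0) ≤ M i j := by
      split_ifs with h
      · exact h ▸ Nat.one_le_iff_ne_zero.2 (hτ i)
      · exact Nat.zero_le _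
    have hτcol (j : n) : ∑ i, (if τ i = j then 1 else 0) = 1 := by
      simp [← Equiv.eq_symm_apply]
    obtain ⟨σ, hσ⟩ := ih (fun i j => M i j - if τ i = j then 1 else 0)
      (fun i => by rw [Finset.sum_tsub_distrib _ fun j _ => hle i j, hrow]; simp)
      (fun j => by rw [Finset.sum_tsub_distrib _ fun i _ => hle i j, hcol, hτcol]; simp)
    refine ⟨fun k => if k = d then τ else σ k, fun i j h => ?_⟩
    by_cases hij : τ i = j
    · exact ⟨d, d.lt_succ_self, by simpa using hij⟩
    · obtain ⟨k, hk, hkj⟩ := hσ i j (by simpa [hij] using h)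
      exact ⟨k, hk.trans d.lt_succ_self, by simpa [hk.ne] using hkj⟩

/-- **Kőnig's edge-coloring theorem**: a bipartite graph of maximum degree at most `d` has a
proper edge-coloring with `d` colors. -/
lemma hasProperEdgeColoring_of_bipartite {V : Type*} [Fintype V] (G : SimpleGraph V)
    [DecidableRel G.Adj] (d : ℕ) (hdeg : ∀ v, G.degree v ≤ d) (A : Set V)
    (hA : ∀ u v, G.Adj u v → (u ∈ A ↔ v ∉ A)) :
    HasProperEdgeColoring G d := by
  classical
  let M (u v : V) : ℕ := (if G.Adj u v then 1 else 0) + if u = v then d - G.degree u else 0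
  have hrow (u : V) : ∑ v, M u v = d := by
    simp only [M, Finset.sum_add_distrib, Finset.sum_ite_eq, Finset.mem_univ, if_true,
      Finset.sum_boole, ← neighborFinset_eq_filter, card_neighborFinset_eq_degree, Nat.cast_id]
    exact Nat.add_sub_cancel' (hdeg u)
  have hsymm (u v : V) : M u v = M v u := by
    by_cases h : u = v
    · rw [h]
    · simp [M, h, Ne.symm h, G.adj_comm]
  obtain ⟨σ, hσ⟩ := exists_perms_covering_support d M hrow
    (fun v => by rw [← hrow v]; exact Finset.sum_congr rfl fun u _ => hsymm u v)
  have hcolor (e : Sym2 V) : ∃ k, e ∈ G.edgeSet →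
      k < d ∧ ∃ a b, a ∈ A ∧ b ∉ A ∧ e = s(a, b) ∧ σ k a = b := by
    by_cases he : e ∈ G.edgeSet
    · induction e with | _ u v
      rw [mem_edgeSet] at he
      have hne {x y : V} (h : G.Adj x y) : M x y ≠ 0 := by simp [M, h]
      by_cases hu : u ∈ A
      · obtain ⟨k, hk, hkv⟩ := hσ u v (hne he)
        exact ⟨k, fun _ => ⟨hk, u, v, hu, (hA u v he).1 hu, rfl, hkv⟩⟩
      · obtain ⟨k, hk, hku⟩ := hσ v u (hne he.symm)
        exact ⟨k, fun _ => ⟨hk, v, u, (hA v u he.symm).2 hu, hu, Sym2.eq_swap, hku⟩⟩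
    · exact ⟨0, fun h => absurd h he⟩
  choose C hC using hcolor
  refine ⟨C, fun e he => (hC e he).1, ?_⟩
  rintro e he f hf hef ⟨v, hve, hvf⟩ hCe
  obtain ⟨-, a, b, ha, hb, rfl, hab⟩ := hC e he
  obtain ⟨-, a', b', ha', hb', rfl, hab'⟩ := hC f hf
  rw [← hCe] at hab'
  apply hef
  rcases Sym2.mem_iff.1 hve with rfl | rfl <;> rcases Sym2.mem_iff.1 hvf with rfl | rfl
  · rw [← hab, ← hab']
  · exact absurd ha hb'
  · exact absurd ha' hb
  · rw [(σ _).injective (hab.trans hab'.symm)]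

/-- A proper edge-coloring of `G` minus an edge `uv` extends to `G`, provided that `uv` is adjacent
to fewer edges than there are colors. -/
lemma HasProperEdgeColoring.of_deleteEdges_singleton {V : Type*} [Fintype V] {G : SimpleGraph V}
    [DecidableRel G.Adj] {t : ℕ} {u v : V} (huv : G.Adj u v)
    (hdeg : G.degree u + G.degree v < t + 2)
    (h : HasProperEdgeColoring (G.deleteEdges {s(u, v)}) t) : HasProperEdgeColoring G t := by
  classical
  obtain ⟨C, hlt, hC⟩ := h
  let N : Finset (Sym2 V) :=
    (G.incidenceFinset u).erase s(u, v) ∪ (G.incidenceFinset v).erase s(u, v)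
  have hu : s(u, v) ∈ G.incidenceFinset u := by simp [mem_incidenceFinset, huv]
  have hv : s(u, v) ∈ G.incidenceFinset v := by
    simp [mem_incidenceFinset, mk'_mem_incidenceSet_iff, huv]
  have hN : (N.image C).card < (Finset.range t).card := by
    refine (Finset.card_image_le.trans (Finset.card_union_le _ _)).trans_lt ?_
    have hu' := (G.degree_pos_iff_exists_adj u).2 ⟨v, huv⟩
    have hv' := (G.degree_pos_iff_exists_adj v).2 ⟨u, huv.symm⟩
    rw [Finset.card_erase_of_mem hu, Finset.card_erase_of_mem hv,
      card_incidenceFinset_eq_degree, card_incidenceFinset_eq_degree, Finset.card_range]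
    omega
  obtain ⟨c, hct, hcN⟩ := Finset.exists_mem_notMem_of_card_lt_card hN
  have hmem {e : Sym2 V} (he : e ∈ G.edgeSet) (hne : e ≠ s(u, v)) :
      e ∈ (G.deleteEdges {s(u, v)}).edgeSet := by
    rw [edgeSet_deleteEdges]; exact ⟨he, hne⟩
  have hnew {e : Sym2 V} (he : e ∈ G.edgeSet) (hne : e ≠ s(u, v))
      (hw : ∃ w, w ∈ s(u, v) ∧ w ∈ e) : c ≠ C e := by
    rintro rfl
    refine hcN (Finset.mem_image_of_mem C ?_)
    obtain ⟨w, hw, hwe⟩ := hw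
    rcases Sym2.mem_iff.1 hw with rfl | rfl
    · simp [N, hne, mem_incidenceFinset, incidenceSet, he, hwe]
    · simp [N, hne, mem_incidenceFinset, incidenceSet, he, hwe]
  refine ⟨Function.update C s(u, v) c, fun e he => ?_, ?_⟩
  · by_cases hne : e = s(u, v)
    · simpa [hne] using hct
    · simpa [hne] using hlt e (hmem he hne)
  · rintro e he f hf hef ⟨w, hwe, hwf⟩
    by_cases h₁ : e = s(u, v) <;> by_cases h₂ : f = s(u, v)
    · exact absurd (h₁.trans h₂.symm) hef
    · simpa [h₁, h₂] using hnew hf h₂ ⟨w, h₁ ▸ hwe, hwf⟩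
    · simpa [h₁, h₂] using (hnew he h₁ ⟨w, h₂ ▸ hwf, hwe⟩).symm
    · simpa [h₁, h₂] using hC e (hmem he h₁) f (hmem hf h₂) hef ⟨w, hwe, hwf⟩

/-- A subcubic graph whose vertices of degree `3` form an independent set has a proper
edge-coloring with `3` colors. -/
lemma hasProperEdgeColoring_three_of_independent {V : Type*} [Fintype V] (G : SimpleGraph V)
    [DecidableRel G.Adj] (hdeg : ∀ v, G.degree v ≤ 3)
    (hind : ∀ u v, G.Adj u v → G.degree u + G.degree v ≤ 5) :
    HasProperEdgeColoring G 3 := by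
  classical
  rename_i inst
  induction G using WellFoundedLT.induction generalizing inst with | _ G ih
  by_cases hlow : ∃ u v, G.Adj u v ∧ G.degree u + G.degree v < 5
  · obtain ⟨u, v, huv, hlt⟩ := hlow
    have hle : G.deleteEdges {s(u, v)} ≤ G := G.deleteEdges_le _
    refine .of_deleteEdges_singleton huv hlt (ih _ (hle.lt_of_not_ge fun h => ?_) ?_ ?_)
    · simpa using h huv
    · exact fun w => (degree_le_of_le hle).trans (hdeg w)
    · exact fun x y hxy =>
        (add_le_add (degree_le_of_le hle) (degree_le_of_le hle)).trans (hind x y (hle hxy))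
  · push Not at hlow
    refine hasProperEdgeColoring_of_bipartite G 3 hdeg {v | G.degree v = 3} fun u v huv => ?_
    have := hdeg u
    have := hdeg v
    have := hlow u v huv
    have := hind u v huv
    simp only [Set.mem_ofPred_eq]
    omega

/-- **Deleting a maximal matching of a subcubic graph leaves a 3-edge-colorable graph.** -/
theorem stmt_13 {V : Type*} [Fintype V] (G : SimpleGraph V) [DecidableRel G.Adj]
    (hsub : ∀ v : V, G.degree v ≤ 3)
    (M : Set (Sym2 V)) (hM : IsMaximalMatchingSet G M) :
    HasProperEdgeColoring (G.deleteEdges M) 3 := by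
  classical
  have hle : G.deleteEdges M ≤ G := G.deleteEdges_le M
  have hdeg (v : V) : (G.deleteEdges M).degree v ≤ 3 := (degree_le_of_le hle).trans (hsub v)
  refine hasProperEdgeColoring_three_of_independent _ hdeg fun u v huv => ?_
  by_contra! hlt
  obtain ⟨⟨hMG, hdisj⟩, hmax⟩ := hM
  have huncovered {w : V} (hw : (G.deleteEdges M).degree w = 3) : ∀ e ∈ M, w ∉ e := by
    intro e he hwe
    obtain ⟨x, rfl⟩ := Sym2.mem_iff_exists.1 hwe
    have heq : (G.deleteEdges M).neighborFinset w = G.neighborFinset w := by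
      refine Finset.eq_of_subset_of_card_le (fun y hy => ?_) ?_
      · rw [mem_neighborFinset] at hy ⊢
        exact hle hy
      · rw [card_neighborFinset_eq_degree, card_neighborFinset_eq_degree, hw]
        exact hsub w
    have hx : x ∈ G.neighborFinset w := by simpa using hMG he
    rw [← heq, mem_neighborFinset, deleteEdges_adj] at hx
    exact hx.2 he
  have hu := huncovered (w := u) (by have := hdeg u; have := hdeg v; omega)
  have hv := huncovered (w := v) (by have := hdeg u; have := hdeg v; omega)
  rw [deleteEdges_adj] at huv
  have hmeet (e : Sym2 V) (he : e ∈ M) (w : V) (hw : w ∈ s(u, v)) : w ∉ e := by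
    rcases Sym2.mem_iff.1 hw with rfl | rfl
    · exact hu e he
    · exact hv e he
  refine hmax s(u, v) huv.1 huv.2 ⟨Set.union_subset hMG (by simpa using huv.1), ?_⟩
  rintro e (he | rfl) f (hf | rfl) hef ⟨w, hwe, hwf⟩
  · exact hdisj e he f hf hef ⟨w, hwe, hwf⟩
  · exact hmeet e he w hwf hwe
  · exact hmeet f hf w hwe hwf
  · exact hef rfl
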